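/- arXiv:1708.04851 — 2 statements merged into one kernel-verified Lean document; each statement's English description precedes it below -/
import Mathlib

section
/- Let n, m be positive integers, A an n×n real matrix and B an n×m real matrix such that the pair (A,B) is controllable (i.e. the columns of B, AB, …, A^{n-1}B span ℂ^n) and B has trivial kernel (its columns are linearly independent). Let λ_1, …, λ_n be distinct complex numbers and v_1, …, v_n be linearly independent vectors in ℂ^n. Then there exists a unique complex m×n matrix F such that (A + B F) v_i = λ_i v_i for every i ∈ {1,…,n} if and only if for every i ∈ {1,…,n} the vector (λ_i I − A) v_i lies in the column space of B (over ℂ). -/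
open Matrix Filter Topology

/-- A matrix is uniquely determined by its values on a linearly independent family of full size,
and these values can be prescribed arbitrarily. -/
theorem Matrix.existsUnique_mulVec_eq {K m n : Type*} [Field K] [Fintype n]
    {v : n → n → K} (hv : LinearIndependent K v) (u : n → m → K) :
    ∃! F : Matrix m n K, ∀ i, F *ᵥ v i = u i := by
  classical
  obtain ⟨b, hb⟩ : ∃ b : Module.Basis n K (n → K), ⇑b = v :=
    ⟨Module.Basis.mk hv (hv.span_eq_top_of_card_eq_finrank' (by simp)).ge, Module.Basis.coe_mk _ _⟩
  subst hb
  refine ⟨LinearMap.toMatrix' (b.constr K u), fun i => ?_, fun G hG => ?_⟩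
  · rw [← Matrix.toLin'_apply, Matrix.toLin'_toMatrix', b.constr_basis]
  · rw [← LinearMap.toMatrix'_toLin' G]
    congr 1
    exact b.ext fun i => by rw [Matrix.toLin'_apply, hG, b.constr_basis]

/-- The closed-loop eigenvector equation, solved for the input term. -/
theorem Matrix.add_mul_mulVec_eq_smul_iff {R m n : Type*} [CommRing R] [Fintype m] [Fintype n]
    [DecidableEq n] (A : Matrix n n R) (B : Matrix n m R) (F : Matrix m n R) (μ : R) (w : n → R) :
    (A + B * F) *ᵥ w = μ • w ↔ (μ • (1 : Matrix n n R) - A) *ᵥ w = B *ᵥ (F *ᵥ w) := by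
  rw [Matrix.add_mulVec, Matrix.sub_mulVec, Matrix.smul_mulVec, Matrix.one_mulVec,
    ← Matrix.mulVec_mulVec, sub_eq_iff_eq_add', eq_comm]

/-- Eigenstructure assignment with distinct eigenvalues (Lemma 1 / Moore 1976).
For a controllable pair `(A,B)` with `B` of trivial kernel, distinct `λ_i` and linearly
independent `v_i`, there is a unique `F` with `(A + B F) v_i = λ_i v_i` for all `i`
iff `(λ_i I - A) v_i` lies in the column space of `B` (over `ℂ`) for all `i`. -/
theorem eigenstructure_assignment_distinct
    (n m : ℕ) (hn : 0 < n) (hm : 0 < m)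
    (A : Matrix (Fin n) (Fin n) ℝ) (B : Matrix (Fin n) (Fin m) ℝ)
    (Ac : Matrix (Fin n) (Fin n) ℂ) (Bc : Matrix (Fin n) (Fin m) ℂ)
    (hAc : Ac = A.map (fun r => (r : ℂ))) (hBc : Bc = B.map (fun r => (r : ℂ)))
    -- controllability: the columns of B, AB, ..., A^{n-1}B span ℂ^n
    (hctrb : Submodule.span ℂ
      (Set.range fun p : Fin n × Fin m => fun i => (Ac ^ (p.1 : ℕ) * Bc) i p.2) = ⊤)
    -- trivial kernel of B (columns linearly independent)
    (hker : Function.Injective Bc.mulVec)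
    (lam : Fin n → ℂ) (hlam : Function.Injective lam)
    (v : Fin n → Fin n → ℂ) (hv : LinearIndependent ℂ v) :
    (∃! F : Matrix (Fin m) (Fin n) ℂ,
        ∀ i : Fin n, (Ac + Bc * F).mulVec (v i) = lam i • v i) ↔
    (∀ i : Fin n, ∃ u : Fin m → ℂ,
        (lam i • (1 : Matrix (Fin n) (Fin n) ℂ) - Ac).mulVec (v i) = Bc.mulVec u) := by
  simp only [Matrix.add_mul_mulVec_eq_smul_iff]
  refine ⟨fun ⟨F, hF, _⟩ i => ⟨F *ᵥ v i, hF i⟩, fun h => ?_⟩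
  choose u hu using h
  simpa only [hu, hker.eq_iff, eq_comm] using Matrix.existsUnique_mulVec_eq hv u
end

section
/- Let n, m be positive integers, A an n×n real matrix and B an n×m real matrix with trivial kernel (linearly independent columns) such that the pair (A,B) is controllable (the columns of B, AB, …, A^{n−1}B span ℂ^n). Let k ≤ n, let d_1,…,d_k be positive integers with d_1 + ⋯ + d_k = n, let λ_1,…,λ_k be complex numbers, and let {v_{i,j} : i ∈ {1,…,k}, j ∈ {1,…,d_i}} be a linearly independent family of vectors in ℂ^n. Then there exists a complex m×n matrix F such that for every i ∈ {1,…,k}: (λ_i I − A − B F) v_{i,1} = 0 and (λ_i I − A − B F) v_{i,j} = v_{i,j−1} for j ∈ {2,…,d_i}, if and only if for every i and j there exist vectors w_{i,j} ∈ ℂ^m such that (λ_i I − A) v_{i,1} = B w_{i,1} and (λ_i I − A) v_{i,j} − B w_{i,j} = v_{i,j−1} for j ∈ {2,…,d_i} (equivalently, (λ_i I − A) v_{i,1} and each (λ_i I − A) v_{i,j} − v_{i,j−1} lie in the column space of B). -/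
open Matrix Filter Topology

/-- A linearly independent family over a field can be sent to any family of values by a matrix. -/
theorem LinearIndependent.exists_matrix_mulVec_eq {K ι m n : Type*} [Field K] [Fintype n]
    [DecidableEq n] {v : ι → n → K} (hv : LinearIndependent K v) (w : ι → m → K) :
    ∃ F : Matrix m n K, ∀ i, F *ᵥ v i = w i := by
  obtain ⟨g, hg⟩ := LinearMap.exists_extend ((Module.Basis.span hv).constr K w)
  refine ⟨LinearMap.toMatrix' g, fun i => ?_⟩
  have h := LinearMap.congr_fun hg (Module.Basis.span hv i)
  rw [Module.Basis.constr_basis, LinearMap.comp_apply, Submodule.subtype_apply,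
    Module.Basis.span_apply] at h
  rw [LinearMap.toMatrix'_mulVec, h]

/-- Lemma 2 of the paper / Moore 1977: eigenstructure assignment with
repeated eigenvalues and chains of generalized eigenvectors.  For a controllable pair
`(A,B)` with `B` of trivial kernel, a feedback `F` realizing the Jordan chains
`(λ_i; v_{i,1}, …, v_{i,d_i})` exists iff `(λ_i I - A) v_{i,1}` and each
`(λ_i I - A) v_{i,j} - v_{i,j-1}` lie in the column space of `B`. -/
theorem eigenstructure_assignment_generalized
    (n m k : ℕ) (hn : 0 < n) (hm : 0 < m) (hk : k ≤ n)
    (A : Matrix (Fin n) (Fin n) ℝ) (B : Matrix (Fin n) (Fin m) ℝ)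
    (Ac : Matrix (Fin n) (Fin n) ℂ) (Bc : Matrix (Fin n) (Fin m) ℂ)
    (hAc : Ac = A.map (fun r => (r : ℂ))) (hBc : Bc = B.map (fun r => (r : ℂ)))
    (hctrb : Submodule.span ℂ
      (Set.range fun p : Fin n × Fin m => fun i => (Ac ^ (p.1 : ℕ) * Bc) i p.2) = ⊤)
    (hker : Function.Injective Bc.mulVec)
    (d : Fin k → ℕ) (hd : ∀ i, 0 < d i) (hsum : ∑ i, d i = n)
    (lam : Fin k → ℂ)
    (v : (i : Fin k) → Fin (d i) → Fin n → ℂ)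
    (hv : LinearIndependent ℂ fun p : (i : Fin k) × Fin (d i) => v p.1 p.2) :
    (∃ F : Matrix (Fin m) (Fin n) ℂ, ∀ i : Fin k,
        (lam i • (1 : Matrix (Fin n) (Fin n) ℂ) - Ac - Bc * F).mulVec
            (v i ⟨0, hd i⟩) = 0 ∧
        ∀ j : Fin (d i), 0 < (j : ℕ) →
          (lam i • (1 : Matrix (Fin n) (Fin n) ℂ) - Ac - Bc * F).mulVec (v i j)
            = v i ⟨(j : ℕ) - 1, lt_of_le_of_lt (Nat.sub_le _ _) j.isLt⟩) ↔
    (∀ i : Fin k,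
        (∃ w : Fin m → ℂ,
          (lam i • (1 : Matrix (Fin n) (Fin n) ℂ) - Ac).mulVec (v i ⟨0, hd i⟩)
            = Bc.mulVec w) ∧
        ∀ j : Fin (d i), 0 < (j : ℕ) →
          ∃ w : Fin m → ℂ,
            (lam i • (1 : Matrix (Fin n) (Fin n) ℂ) - Ac).mulVec (v i j) - Bc.mulVec w
              = v i ⟨(j : ℕ) - 1, lt_of_le_of_lt (Nat.sub_le _ _) j.isLt⟩) := by
  constructor
  · rintro ⟨F, hF⟩ i
    simp only [sub_mulVec _ (Bc * F), ← mulVec_mulVec] at hF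
    exact ⟨⟨F *ᵥ v i ⟨0, hd i⟩, sub_eq_zero.mp (hF i).1⟩,
      fun j hj => ⟨F *ᵥ v i j, (hF i).2 j hj⟩⟩
  · intro h
    have hw : ∀ p : (i : Fin k) × Fin (d i), ∃ w : Fin m → ℂ,
        ((p.2 : ℕ) = 0 → (lam p.1 • (1 : Matrix (Fin n) (Fin n) ℂ) - Ac) *ᵥ v p.1 p.2
          = Bc *ᵥ w) ∧
        (0 < (p.2 : ℕ) → (lam p.1 • (1 : Matrix (Fin n) (Fin n) ℂ) - Ac) *ᵥ v p.1 p.2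
          - Bc *ᵥ w = v p.1 ⟨(p.2 : ℕ) - 1, lt_of_le_of_lt (Nat.sub_le _ _) p.2.isLt⟩) := by
      rintro ⟨i, j, hj⟩
      rcases Nat.eq_zero_or_pos j with rfl | hpos
      · obtain ⟨w, hw⟩ := (h i).1
        exact ⟨w, fun _ => hw, fun h0 => absurd h0 (lt_irrefl 0)⟩
      · obtain ⟨w, hw⟩ := (h i).2 ⟨j, hj⟩ hpos
        exact ⟨w, fun h0 => absurd h0 hpos.ne', fun _ => hw⟩
    choose w hw using hw
    obtain ⟨F, hF⟩ := hv.exists_matrix_mulVec_eq w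
    refine ⟨F, fun i => ⟨?_, fun j hj => ?_⟩⟩
    · rw [sub_mulVec _ (Bc * F), ← mulVec_mulVec, hF ⟨i, ⟨0, hd i⟩⟩, sub_eq_zero]
      exact (hw ⟨i, ⟨0, hd i⟩⟩).1 rfl
    · rw [sub_mulVec _ (Bc * F), ← mulVec_mulVec, hF ⟨i, j⟩]
      exact (hw ⟨i, j⟩).2 hj
end
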